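/- Let U ⊆ ℝ^D be open, let I : U → Matrix (Fin D) (Fin D) ℝ be a C¹ map with I(x)·I(x) = -1 (minus the identity matrix) for every x ∈ U, and let z : U → ℂ be a twice continuously differentiable function satisfying the complex-coordinate equations for I. Then for every x ∈ U and all indices M, N one has Σ_K N_{MN}{}^K(x) · ∂_K z(x) = 0, where N is the Nijenhuis tensor of I. -/

import Mathlib

open scoped BigOperators

/-- Partial derivative in the `P`-th coordinate direction of a real-valued function on `ℝ^D`. -/
noncomputable def pd {D : ℕ} (f : (Fin D → ℝ) → ℝ) (P : Fin D) (x : Fin D → ℝ) : ℝ :=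
  fderiv ℝ f x (Pi.single P 1)

/-- Partial derivative in the `P`-th coordinate direction of a complex-valued function on `ℝ^D`. -/
noncomputable def pdC {D : ℕ} (f : (Fin D → ℝ) → ℂ) (P : Fin D) (x : Fin D → ℝ) : ℂ :=
  fderiv ℝ f x (Pi.single P 1)

/-- The Nijenhuis tensor `N_{MN}{}^K` of a matrix field `I` on `ℝ^D`. -/
noncomputable def nijenhuis {D : ℕ} (I : (Fin D → ℝ) → Matrix (Fin D) (Fin D) ℝ)
    (x : Fin D → ℝ) (M N K : Fin D) : ℝ :=
  (pd (fun y => I y N K) M x - pd (fun y => I y M K) N x)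
    - ∑ P, ∑ Q, I x M P * I x N Q *
        (pd (fun y => I y Q K) P x - pd (fun y => I y P K) Q x)

/-- `z` satisfies the complex-coordinate equations `∂_M z - i I_M{}^N ∂_N z = 0` for `I` at `x`. -/
def ComplexCoordEq {D : ℕ} (I : (Fin D → ℝ) → Matrix (Fin D) (Fin D) ℝ)
    (z : (Fin D → ℝ) → ℂ) (x : Fin D → ℝ) : Prop :=
  ∀ M : Fin D, pdC z M x - Complex.I * ∑ N, (I x M N : ℂ) * pdC z N x = 0

/-- If `J ^ 2 = -1`, the matrix `J * H - H * Jᵀ` is invariant under `A ↦ J * A * Jᵀ`. -/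
theorem commutator_transpose_eq_conj {n R : Type*} [Fintype n] [DecidableEq n] [CommRing R]
    (J H : Matrix n n R) (hJ : J * J = -1) :
    J * H - H * J.transpose = J * (J * H - H * J.transpose) * J.transpose := by
  have hT : J.transpose * J.transpose = -1 := by
    rw [← Matrix.transpose_mul, hJ, Matrix.transpose_neg, Matrix.transpose_one]
  calc J * H - H * J.transpose
      = (J * J) * H * J.transpose - J * H * (J.transpose * J.transpose) := by
        rw [hJ, hT]; noncomm_ring
    _ = _ := by noncomm_ring

theorem differentiableAt_pdC {D : ℕ} {z : (Fin D → ℝ) → ℂ} {x : Fin D → ℝ}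
    (hz : ContDiffAt ℝ 2 z x) (K : Fin D) : DifferentiableAt ℝ (pdC z K) x := by
  have h : DifferentiableAt ℝ (fderiv ℝ z) x :=
    (hz.fderiv_right (m := 1) (by norm_num)).differentiableAt (by norm_num)
  exact h.clm_apply (differentiableAt_const _)

/-- Second partial derivatives of a `C²` function commute. -/
theorem pdC_pdC_comm {D : ℕ} {z : (Fin D → ℝ) → ℂ} {x : Fin D → ℝ}
    (hz : ContDiffAt ℝ 2 z x) (M N : Fin D) : pdC (pdC z N) M x = pdC (pdC z M) N x := by
  have h : DifferentiableAt ℝ (fderiv ℝ z) x :=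
    (hz.fderiv_right (m := 1) (by norm_num)).differentiableAt (by norm_num)
  have key : ∀ P K : Fin D, pdC (pdC z K) P x =
      fderiv ℝ (fderiv ℝ z) x (Pi.single P 1) (Pi.single K 1) := by
    intro P K
    have := (h.hasFDerivAt.clm_apply (hasFDerivAt_const (Pi.single K (1 : ℝ)) x)).fderiv
    change fderiv ℝ (fun y => fderiv ℝ z y (Pi.single K 1)) x (Pi.single P 1) = _
    rw [this]
    simp
  rw [key, key]
  exact (hz.isSymmSndFDerivAt (by simp)) _ _

/-- The derivative of the complex-coordinate equations. -/
theorem pdC_pdC_of_complexCoordEq {D : ℕ} {I : (Fin D → ℝ) → Matrix (Fin D) (Fin D) ℝ}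
    {z : (Fin D → ℝ) → ℂ} {x : Fin D → ℝ}
    (hI : ∀ N K : Fin D, DifferentiableAt ℝ (fun y => I y N K) x)
    (hz : ContDiffAt ℝ 2 z x) (h : ∀ᶠ y in nhds x, ComplexCoordEq I z y) (M N : Fin D) :
    pdC (pdC z N) M x = Complex.I * ∑ K,
      ((pd (fun y => I y N K) M x : ℂ) * pdC z K x + (I x N K : ℂ) * pdC (pdC z K) M x) := by
  have heq : pdC z N =ᶠ[nhds x] fun y => Complex.I * ∑ K, (I y N K : ℂ) * pdC z K y := by
    filter_upwards [h] with y hy using sub_eq_zero.mp (hy N)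
  have hder : HasFDerivAt (fun y => Complex.I * ∑ K, (I y N K : ℂ) * pdC z K y) _ x :=
    (HasFDerivAt.fun_sum (u := Finset.univ) fun K _ =>
      (Complex.ofRealCLM.hasFDerivAt.comp x (hI N K).hasFDerivAt).mul
        (differentiableAt_pdC hz K).hasFDerivAt).const_mul Complex.I
  conv_lhs => rw [pdC, heq.fderiv_eq, hder.fderiv]
  simp only [smul_apply, sum_apply, add_apply, ContinuousLinearMap.comp_apply, smul_eq_mul, pd,
    Function.comp_apply, Complex.ofRealCLM_apply]
  congr 1
  refine Finset.sum_congr rfl fun K _ => ?_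
  change (I x N K : ℂ) * pdC (pdC z K) M x + _ = _
  ring

theorem nijenhuis_contracts_gradient (D : ℕ) (U : Set (Fin D → ℝ)) (hU : IsOpen U)
    (I : (Fin D → ℝ) → Matrix (Fin D) (Fin D) ℝ)
    (hIsmooth : ∀ N K : Fin D, ContDiffOn ℝ 1 (fun y => I y N K) U)
    (hI2 : ∀ x ∈ U, I x * I x = -1)
    (z : (Fin D → ℝ) → ℂ) (hz : ContDiffOn ℝ 2 z U)
    (hzeq : ∀ x ∈ U, ComplexCoordEq I z x) :
    ∀ x ∈ U, ∀ M N : Fin D, ∑ K, (nijenhuis I x M N K : ℂ) * pdC z K x = 0 := by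
  intro x hx M N
  have hzx : ContDiffAt ℝ 2 z x := hz.contDiffAt (hU.mem_nhds hx)
  have hIx : ∀ N K : Fin D, DifferentiableAt ℝ (fun y => I y N K) x := fun N K =>
    ((hIsmooth N K).contDiffAt (hU.mem_nhds hx)).differentiableAt (by norm_num)
  have hev : ∀ᶠ y in nhds x, ComplexCoordEq I z y :=
    Filter.eventually_of_mem (hU.mem_nhds hx) hzeq
  let J : Matrix (Fin D) (Fin D) ℂ := (I x).map Complex.ofRealHom
  let H : Matrix (Fin D) (Fin D) ℂ := fun P K => pdC (pdC z K) P x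
  let A : Matrix (Fin D) (Fin D) ℂ := fun P Q =>
    ∑ K, ((pd (fun y => I y Q K) P x : ℂ) - (pd (fun y => I y P K) Q x : ℂ)) * pdC z K x
  have hJ : J * J = -1 := by
    change (I x).map Complex.ofRealHom * (I x).map Complex.ofRealHom = -1
    rw [← Matrix.map_mul, hI2 x hx]
    ext i j
    by_cases hij : i = j <;> simp [hij]
  have hA : A = J * H - H * J.transpose := by
    ext P Q
    have h1 := pdC_pdC_of_complexCoordEq hIx hzx hev P Q
    have h2 := pdC_pdC_of_complexCoordEq hIx hzx hev Q P
    rw [pdC_pdC_comm hzx P Q, h2] at h1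
    have h3 := mul_left_cancel₀ Complex.I_ne_zero h1
    simp only [Finset.sum_add_distrib] at h3
    have h4 : (J * H) P Q = ∑ K, (I x P K : ℂ) * pdC (pdC z K) Q x := by
      rw [Matrix.mul_apply]
      exact Finset.sum_congr rfl fun K _ => by
        rw [pdC_pdC_comm hzx Q K]; rfl
    have h5 : (H * J.transpose) P Q = ∑ K, (I x Q K : ℂ) * pdC (pdC z K) P x := by
      rw [Matrix.mul_apply]
      exact Finset.sum_congr rfl fun K _ => mul_comm _ _
    rw [Matrix.sub_apply, h4, h5]
    simp only [A, sub_mul, Finset.sum_sub_distrib]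
    linear_combination -h3
  have hinv : A = J * A * J.transpose := by
    rw [hA]
    exact commutator_transpose_eq_conj J H hJ
  have hconj : (J * A * J.transpose) M N =
      ∑ P, ∑ Q, (I x M P : ℂ) * (I x N Q : ℂ) * A P Q := by
    simp only [Matrix.mul_apply, Finset.sum_mul]
    rw [Finset.sum_comm]
    refine Finset.sum_congr rfl fun P _ => Finset.sum_congr rfl fun Q _ => ?_
    change (I x M P : ℂ) * A P Q * (I x N Q : ℂ) = _
    ring
  have hsum : ∑ K, (nijenhuis I x M N K : ℂ) * pdC z K x =
      A M N - ∑ P, ∑ Q, (I x M P : ℂ) * (I x N Q : ℂ) * A P Q := by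
    simp only [nijenhuis, A, Complex.ofReal_sub, Complex.ofReal_sum, Complex.ofReal_mul]
    simp only [sub_mul _ (∑ P, _) _, Finset.sum_sub_distrib (f := fun K => _ * pdC z K x),
      Finset.sum_mul, Finset.mul_sum]
    congr 1
    rw [Finset.sum_comm]
    refine Finset.sum_congr rfl fun P _ => ?_
    rw [Finset.sum_comm]
    exact Finset.sum_congr rfl fun Q _ => Finset.sum_congr rfl fun K _ => by ring
  rw [hsum, ← hconj, ← hinv, sub_self]
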